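/- arXiv:1405.1504 — 3 statements merged into one kernel-verified Lean document; each statement's English description precedes it below -/
import Mathlib

section
/- Let 0 < a ≤ 1. The Hurwitz zeta function satisfies ζ(σ,a) ≠ 0 for every real σ with 0 < σ < 1 if and only if a ≥ 1/2. -/
open HurwitzZeta

/-- The error of the midpoint rule for `∫ y in x - 1/2..x + 1/2, y ^ (-s)`. -/
noncomputable def midpointError (x : ℝ) (s : ℂ) : ℂ :=
  (x : ℂ) ^ (-s) - (((x + 1 / 2 : ℝ) : ℂ) ^ (1 - s) - ((x - 1 / 2 : ℝ) : ℂ) ^ (1 - s)) / (1 - s)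

lemma hasDerivAt_ofReal_add_mul_cpow (m e : ℝ) (r : ℂ) {t : ℝ} (ht : 0 < m + e * t) :
    HasDerivAt (fun t : ℝ ↦ ((m + e * t : ℝ) : ℂ) ^ r)
      (r * ((m + e * t : ℝ) : ℂ) ^ (r - 1) * e) t := by
  have h1 : HasDerivAt (fun z : ℂ ↦ (m : ℂ) + e * z) e (t : ℂ) := by
    simpa using ((hasDerivAt_id (t : ℂ)).const_mul (e : ℂ)).const_add (m : ℂ)
  have h2 : (m : ℂ) + e * t ∈ Complex.slitPlane := by
    have : (m : ℂ) + e * t = ((m + e * t : ℝ) : ℂ) := by push_cast; rfl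
    rw [this]
    exact Complex.ofReal_mem_slitPlane.2 ht
  have := (h1.cpow_const (c := r) h2).comp_ofReal
  simpa using this

/-- A function vanishing at `0` whose derivative is bounded by `C` on `[0, 1/2]` is
bounded by `C` there. -/
lemma norm_le_of_norm_deriv_le_Icc_half {f f' : ℝ → ℂ} {C : ℝ} (h0 : f 0 = 0)
    (hf : ∀ t ∈ Set.Icc (0 : ℝ) (1 / 2), HasDerivAt f (f' t) t)
    (hC : ∀ t ∈ Set.Icc (0 : ℝ) (1 / 2), ‖f' t‖ ≤ C) :
    ∀ t ∈ Set.Icc (0 : ℝ) (1 / 2), ‖f t‖ ≤ C := by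
  intro t ht
  have hC0 : 0 ≤ C := (norm_nonneg _).trans (hC t ht)
  have := norm_image_sub_le_of_norm_deriv_le_segment'
    (fun x hx ↦ (hf x hx).hasDerivWithinAt) (fun x hx ↦ hC x ⟨hx.1, hx.2.le⟩) t ht
  rw [h0, sub_zero, sub_zero] at this
  nlinarith [ht.1, ht.2]

lemma norm_midpointError_le {x : ℝ} (hx : 1 / 2 < x) {s : ℂ} (hs : s ≠ 1) (hs' : -2 ≤ s.re) :
    ‖midpointError x s‖ ≤ 2 * (‖s‖ * ‖s + 1‖ * (x - 1 / 2) ^ (-s.re - 2)) := by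
  have hs1 : 1 - s ≠ 0 := sub_ne_zero.2 hs.symm
  have hp : ∀ t ∈ Set.Icc (0 : ℝ) (1 / 2), 0 < x + 1 * t := fun t ht ↦ by linarith [ht.1]
  have hm : ∀ t ∈ Set.Icc (0 : ℝ) (1 / 2), 0 < x + (-1) * t := fun t ht ↦ by linarith [ht.2]
  have hbd : ∀ y, x - 1 / 2 ≤ y →
      ‖-s * ((-s - 1) * (y : ℂ) ^ (-s - 1 - 1))‖
        ≤ ‖s‖ * ‖s + 1‖ * (x - 1 / 2) ^ (-s.re - 2) := by
    intro y hy
    have hy0 : 0 < y := by linarith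
    have e1 : ‖-s - 1‖ = ‖s + 1‖ := by rw [← norm_neg]; ring_nf
    rw [norm_mul, norm_mul, norm_neg, e1, Complex.norm_cpow_eq_rpow_re_of_pos hy0, mul_assoc]
    have e2 : (-s - 1 - 1).re = -s.re - 2 := by simp; ring
    rw [e2]
    have h := Real.rpow_le_rpow_of_nonpos (z := -s.re - 2) (by linarith) hy (by linarith)
    exact mul_le_mul_of_nonneg_left (mul_le_mul_of_nonneg_left h (norm_nonneg _)) (norm_nonneg _)
  have h1 := norm_le_of_norm_deriv_le_Icc_half
    (f := fun t ↦ -s * ((x + 1 * t : ℝ) : ℂ) ^ (-s - 1) - -s * ((x + (-1) * t : ℝ) : ℂ) ^ (-s - 1))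
    (C := 2 * (‖s‖ * ‖s + 1‖ * (x - 1 / 2) ^ (-s.re - 2))) (by simp)
    (fun t ht ↦ ((hasDerivAt_ofReal_add_mul_cpow x 1 (-s - 1) (hp t ht)).const_mul (-s)).sub
      ((hasDerivAt_ofReal_add_mul_cpow x (-1) (-s - 1) (hm t ht)).const_mul (-s)))
    (fun t ht ↦ by
      have b1 := hbd (x + 1 * t) (by linarith [ht.1])
      have b2 := hbd (x + (-1) * t) (by linarith [ht.2])
      refine (norm_sub_le _ _).trans ?_
      rw [two_mul]
      refine add_le_add (le_trans (le_of_eq ?_) b1) (le_trans (le_of_eq ?_) b2)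
      · simp
      · rw [← norm_neg]; congr 1; push_cast; ring)
  have h2 := norm_le_of_norm_deriv_le_Icc_half
    (f := fun t ↦ ((x + 1 * t : ℝ) : ℂ) ^ (-s) + ((x + (-1) * t : ℝ) : ℂ) ^ (-s)
      - 2 * (x : ℂ) ^ (-s))
    (C := 2 * (‖s‖ * ‖s + 1‖ * (x - 1 / 2) ^ (-s.re - 2))) (by simp; ring)
    (fun t ht ↦ ((hasDerivAt_ofReal_add_mul_cpow x 1 (-s) (hp t ht)).add
      (hasDerivAt_ofReal_add_mul_cpow x (-1) (-s) (hm t ht))).sub_const _)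
    (fun t ht ↦ by
      refine le_trans (le_of_eq ?_) (h1 t ht)
      congr 1; push_cast; ring)
  have h3 := norm_le_of_norm_deriv_le_Icc_half
    (f := fun t ↦ (((x + 1 * t : ℝ) : ℂ) ^ (1 - s) - ((x + (-1) * t : ℝ) : ℂ) ^ (1 - s)) / (1 - s)
      - (t : ℂ) * (2 * (x : ℂ) ^ (-s)))
    (C := 2 * (‖s‖ * ‖s + 1‖ * (x - 1 / 2) ^ (-s.re - 2))) (by simp)
    (fun t ht ↦ (((hasDerivAt_ofReal_add_mul_cpow x 1 (1 - s) (hp t ht)).sub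
      (hasDerivAt_ofReal_add_mul_cpow x (-1) (1 - s) (hm t ht))).div_const _).sub
        ((hasDerivAt_id t).ofReal_comp.mul_const _))
    (fun t ht ↦ by
      refine le_trans (le_of_eq ?_) (h2 t ht)
      congr 1
      rw [show 1 - s - 1 = -s by ring]
      field_simp
      push_cast
      ring)
  refine le_trans (le_of_eq ?_) (h3 (1 / 2) ⟨by norm_num, le_rfl⟩)
  rw [midpointError, ← norm_neg]
  congr 1
  rw [show x + 1 * (1 / 2) = x + 1 / 2 by ring, show x + -1 * (1 / 2) = x - 1 / 2 by ring]
  push_cast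
  ring

lemma differentiableAt_midpointError {x : ℝ} (hx : 1 / 2 < x) {s : ℂ} (hs : s ≠ 1) :
    DifferentiableAt ℂ (midpointError x) s := by
  have hs1 : 1 - s ≠ 0 := sub_ne_zero.2 hs.symm
  have h1 : (x : ℂ) ≠ 0 := by exact_mod_cast (by linarith : x ≠ 0)
  have h2 : ((x + 1 / 2 : ℝ) : ℂ) ≠ 0 := by exact_mod_cast (by linarith : x + 1 / 2 ≠ 0)
  have h3 : ((x - 1 / 2 : ℝ) : ℂ) ≠ 0 := by exact_mod_cast (by linarith : x - 1 / 2 ≠ 0)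
  have d1 : DifferentiableAt ℂ (fun s : ℂ ↦ 1 - s) s := by fun_prop
  have d2 : DifferentiableAt ℂ (fun s : ℂ ↦ -s) s := by fun_prop
  exact (d2.const_cpow (.inl h1)).sub
    (((d1.const_cpow (.inl h2)).sub (d1.const_cpow (.inl h3))).div d1 hs1)

lemma midpointError_zero {x : ℝ} : midpointError x 0 = 0 := by
  simp [midpointError]; ring

/-- The midpoint rule underestimates the integral of the convex function `y ↦ y ^ (-σ)`. -/
lemma midpointError_ofReal {x σ : ℝ} (hx : 1 / 2 < x) (hσ : 0 ≤ σ) (hσ' : σ < 1) :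
    ∃ r : ℝ, r ≤ 0 ∧ midpointError x σ = r := by
  have hp : ∀ t ∈ Set.Icc (0 : ℝ) (1 / 2), 0 < x + t := fun t ht ↦ by linarith [ht.1]
  have hm : ∀ t ∈ Set.Icc (0 : ℝ) (1 / 2), 0 < x - t := fun t ht ↦ by linarith [ht.2]
  refine ⟨x ^ (-σ) - ((x + 1 / 2) ^ (1 - σ) - (x - 1 / 2) ^ (1 - σ)) / (1 - σ), ?_, ?_⟩
  · let h : ℝ → ℝ := fun t ↦ ((x + t) ^ (1 - σ) - (x - t) ^ (1 - σ)) / (1 - σ) - t * (2 * x ^ (-σ))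
    have hd : ∀ t ∈ Set.Icc (0 : ℝ) (1 / 2), HasDerivAt h
        ((x + t) ^ (-σ) + (x - t) ^ (-σ) - 2 * x ^ (-σ)) t := by
      intro t ht
      have a1 := ((hasDerivAt_id t).const_add x).rpow_const (p := 1 - σ) (.inl (hp t ht).ne')
      have a2 := ((hasDerivAt_id t).const_sub x).rpow_const (p := 1 - σ) (.inl (hm t ht).ne')
      have := ((a1.sub a2).div_const (1 - σ)).sub ((hasDerivAt_id t).mul_const (2 * x ^ (-σ)))
      refine HasDerivAt.congr_deriv this ?_
      have : 1 - σ ≠ 0 := by linarith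
      simp only [id, show 1 - σ - 1 = -σ by ring]
      field_simp
      ring
    have hmono : MonotoneOn h (Set.Icc 0 (1 / 2)) := by
      refine monotoneOn_of_deriv_nonneg (convex_Icc _ _)
        (fun t ht ↦ (hd t ht).continuousAt.continuousWithinAt)
        (fun t ht ↦ (hd t (interior_subset ht)).differentiableAt.differentiableWithinAt) ?_
      intro t ht
      have ht := interior_subset ht
      rw [(hd t ht).deriv]
      have hA := hp t ht
      have hB := hm t ht
      set A := (x + t) ^ (-σ / 2) with hAdef
      set B := (x - t) ^ (-σ / 2) with hBdef
      have eA : (x + t) ^ (-σ) = A ^ 2 := by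
        rw [hAdef, ← Real.rpow_natCast, ← Real.rpow_mul hA.le]; norm_num
      have eB : (x - t) ^ (-σ) = B ^ 2 := by
        rw [hBdef, ← Real.rpow_natCast, ← Real.rpow_mul hB.le]; norm_num
      have eX : x ^ (-σ) ≤ A * B := by
        rw [hAdef, hBdef, ← Real.mul_rpow hA.le hB.le]
        have : x ^ (-σ) = (x ^ 2) ^ (-σ / 2) := by
          rw [← Real.rpow_natCast, ← Real.rpow_mul (by linarith)]; congr 1; push_cast; ring
        rw [this]
        exact Real.rpow_le_rpow_of_nonpos (mul_pos hA hB) (by nlinarith [sq_nonneg t]) (by linarith)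
      rw [eA, eB]
      nlinarith [sq_nonneg (A - B)]
    have := hmono (Set.left_mem_Icc.2 (by norm_num)) (Set.right_mem_Icc.2 (by norm_num))
      (by norm_num : (0 : ℝ) ≤ 1 / 2)
    simp only [h, add_zero, sub_zero, sub_self, zero_div, zero_mul] at this
    linarith
  · rw [midpointError]
    push_cast [Complex.ofReal_cpow (by linarith : 0 ≤ x),
      Complex.ofReal_cpow (by linarith : 0 ≤ x + 1 / 2),
      Complex.ofReal_cpow (by linarith : 0 ≤ x - 1 / 2)]
    rfl

lemma summable_nat_add_one_rpow :
    Summable (fun n : ℕ ↦ 768 * ((n : ℝ) + 1) ^ (-(3 / 2) : ℝ)) := by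
  refine Summable.mul_left _ ?_
  have := (summable_nat_add_iff 1).2 (Real.summable_nat_rpow.2 (by norm_num : (-(3 / 2) : ℝ) < -1))
  simpa using this

/-- The part of the region of validity of the midpoint expansion needed here. -/
def midpointRegion : Set ℂ := {s | -(1 / 2) < s.re} ∩ Metric.ball 0 3

lemma isOpen_midpointRegion : IsOpen midpointRegion :=
  (isOpen_lt continuous_const Complex.continuous_re).inter Metric.isOpen_ball

lemma norm_midpointError_nat_le {a : ℝ} (ha : 0 < a) (n : ℕ) {s : ℂ} (hs : s ≠ 1)
    (hsU : s ∈ midpointRegion) :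
    ‖midpointError (n + 1 + a) s‖ ≤ 768 * ((n : ℝ) + 1) ^ (-(3 / 2) : ℝ) := by
  obtain ⟨h1, h2⟩ := hsU
  simp only [Set.mem_ofPred_eq] at h1
  rw [mem_ball_zero_iff] at h2
  have hn : (0 : ℝ) ≤ n := n.cast_nonneg
  have hre : s.re ≤ 3 := (Complex.re_le_norm s).trans h2.le
  have h3 : ‖s + 1‖ ≤ 4 := (norm_add_le _ _).trans (by rw [norm_one]; linarith)
  refine (norm_midpointError_le (by linarith) hs (by linarith)).trans ?_
  have h4 : ((n : ℝ) + 1 + a - 1 / 2) ^ (-s.re - 2) ≤ 32 * ((n : ℝ) + 1) ^ (-(3 / 2) : ℝ) := by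
    calc ((n : ℝ) + 1 + a - 1 / 2) ^ (-s.re - 2)
        ≤ (1 / 2 * ((n : ℝ) + 1)) ^ (-s.re - 2) :=
          Real.rpow_le_rpow_of_nonpos (by positivity) (by linarith) (by linarith)
      _ = (1 / 2) ^ (-s.re - 2) * ((n : ℝ) + 1) ^ (-s.re - 2) :=
          Real.mul_rpow (by norm_num) (by positivity)
      _ ≤ (1 / 2) ^ (-5 : ℝ) * ((n : ℝ) + 1) ^ (-(3 / 2) : ℝ) := by
          gcongr ?_ * ?_
          · exact Real.rpow_le_rpow_of_exponent_ge (by norm_num) (by norm_num) (by linarith)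
          · exact Real.rpow_le_rpow_of_exponent_le (by linarith) (by linarith)
      _ = 32 * ((n : ℝ) + 1) ^ (-(3 / 2) : ℝ) := by
          congr 1
          rw [Real.rpow_neg (by norm_num)]
          norm_num
  have h5 : ‖s‖ * ‖s + 1‖ ≤ 3 * 4 := by gcongr
  calc 2 * (‖s‖ * ‖s + 1‖ * ((n : ℝ) + 1 + a - 1 / 2) ^ (-s.re - 2))
      ≤ 2 * (3 * 4 * (32 * ((n : ℝ) + 1) ^ (-(3 / 2) : ℝ))) := by
        have : 0 ≤ ((n : ℝ) + 1 + a - 1 / 2) ^ (-s.re - 2) := Real.rpow_nonneg (by linarith) _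
        gcongr
    _ = _ := by ring

lemma summable_midpointError {a : ℝ} (ha : 0 < a) {s : ℂ} (hs : s ≠ 1)
    (hsU : s ∈ midpointRegion) : Summable (fun n : ℕ ↦ midpointError (n + 1 + a) s) :=
  .of_norm_bounded summable_nat_add_one_rpow fun n ↦ norm_midpointError_nat_le ha n hs hsU

/-- The analytic continuation of the Hurwitz zeta function given by the midpoint rule. -/
noncomputable def midpointZeta (a : ℝ) (s : ℂ) : ℂ :=
  (a : ℂ) ^ (-s) + ∑' n : ℕ, midpointError (n + 1 + a) s -
    ((a + 1 / 2 : ℝ) : ℂ) ^ (1 - s) / (1 - s)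

lemma differentiableOn_midpointZeta {a : ℝ} (ha : 0 < a) :
    DifferentiableOn ℂ (midpointZeta a) (midpointRegion ∩ {1}ᶜ) := by
  have h1 : (a : ℂ) ≠ 0 := by exact_mod_cast ha.ne'
  have h2 : ((a + 1 / 2 : ℝ) : ℂ) ≠ 0 := by exact_mod_cast (by linarith : a + 1 / 2 ≠ 0)
  have d1 : Differentiable ℂ (fun s : ℂ ↦ 1 - s) := by fun_prop
  have d2 : Differentiable ℂ (fun s : ℂ ↦ -s) := by fun_prop
  have hsum : DifferentiableOn ℂ (fun s ↦ ∑' n : ℕ, midpointError (n + 1 + a) s)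
      (midpointRegion ∩ {1}ᶜ) := by
    refine Complex.differentiableOn_tsum_of_summable_norm summable_nat_add_one_rpow ?_
      (isOpen_midpointRegion.inter isOpen_compl_singleton) ?_
    · intro n s hs
      have hn : (0 : ℝ) ≤ n := n.cast_nonneg
      exact (differentiableAt_midpointError (by linarith) hs.2).differentiableWithinAt
    · exact fun n s hs ↦ norm_midpointError_nat_le ha n hs.2 hs.1
  refine (DifferentiableOn.add (fun s _ ↦ ?_) hsum).sub (fun s hs ↦ ?_)
  · exact ((d2 s).const_cpow (.inl h1)).differentiableWithinAt
  · exact (((d1 s).const_cpow (.inl h2)).div (d1 s)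
      (sub_ne_zero.2 (Ne.symm hs.2))).differentiableWithinAt

open Filter Topology in
lemma hurwitzZeta_eq_midpointZeta_of_one_lt_re {a : ℝ} (ha : 0 < a) (ha' : a ≤ 1) {s : ℂ}
    (hs : 1 < s.re) (hsU : s ∈ midpointRegion) : hurwitzZeta a s = midpointZeta a s := by
  have hs1 : s ≠ 1 := by rintro rfl; simp at hs
  have hz := hasSum_hurwitzZeta_of_one_lt_re ⟨ha.le, ha'⟩ hs
  have hz' := (hasSum_nat_add_iff' 1).2 hz
  have hF : ∀ N : ℕ, ∑ n ∈ Finset.range N, midpointError (n + 1 + a) s =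
      ∑ n ∈ Finset.range N, 1 / (((n + 1 : ℕ) : ℂ) + a) ^ s -
      ((((N + a + 1 / 2 : ℝ) : ℂ) ^ (1 - s)) / (1 - s) -
        ((a + 1 / 2 : ℝ) : ℂ) ^ (1 - s) / (1 - s)) := by
    intro N
    induction N with
    | zero => simp
    | succ N ih =>
      rw [Finset.sum_range_succ, ih, Finset.sum_range_succ, midpointError]
      rw [show (N : ℝ) + 1 + a - 1 / 2 = N + a + 1 / 2 by ring,
        show (N : ℝ) + 1 + a + 1 / 2 = ((N + 1 : ℕ) : ℝ) + a + 1 / 2 by push_cast; ring,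
        Complex.cpow_neg, ← one_div]
      push_cast
      ring
  have hlim : Tendsto (fun N : ℕ ↦ ((N + a + 1 / 2 : ℝ) : ℂ) ^ (1 - s) / (1 - s))
      atTop (𝓝 0) := by
    rw [← zero_div (1 - s)]
    refine Tendsto.div_const ?_ _
    rw [tendsto_zero_iff_norm_tendsto_zero]
    have : ∀ N : ℕ, ‖((N + a + 1 / 2 : ℝ) : ℂ) ^ (1 - s)‖ = (N + a + 1 / 2) ^ (-(s.re - 1)) := by
      intro N
      rw [Complex.norm_cpow_eq_rpow_re_of_pos (by positivity)]
      simp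
    simp_rw [this]
    refine (tendsto_rpow_neg_atTop (by linarith)).comp ?_
    simp_rw [add_assoc]
    exact tendsto_atTop_add_const_right _ _ tendsto_natCast_atTop_atTop
  have h1 := (summable_midpointError ha hs1 hsU).hasSum.tendsto_sum_nat
  have h2 := hz'.tendsto_sum_nat.sub (hlim.sub_const (((a + 1 / 2 : ℝ) : ℂ) ^ (1 - s) / (1 - s)))
  simp_rw [hF] at h1
  have := tendsto_nhds_unique h1 h2
  rw [midpointZeta, this, Complex.cpow_neg]
  simp only [Finset.range_one, Finset.sum_singleton, Nat.cast_zero, zero_add]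
  ring

open Filter Topology in
lemma hurwitzZeta_ofReal_eq_midpointZeta {a : ℝ} (ha : 0 < a) (ha' : a ≤ 1) {σ : ℝ}
    (hσ : 0 ≤ σ) (hσ' : σ < 1) : hurwitzZeta a (σ : ℂ) = midpointZeta a (σ : ℂ) := by
  have hopen : IsOpen (midpointRegion ∩ {1}ᶜ) :=
    isOpen_midpointRegion.inter isOpen_compl_singleton
  set V : Set ℂ := midpointRegion ∩ {s | 0 < s.im} with hV
  have hVsub : V ⊆ midpointRegion ∩ {1}ᶜ := by
    rintro s ⟨h1, h2⟩
    refine ⟨h1, ?_⟩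
    rintro rfl
    simp at h2
  have hVopen : IsOpen V :=
    isOpen_midpointRegion.inter (isOpen_lt continuous_const Complex.continuous_im)
  have hVconv : Convex ℝ V :=
    ((convex_halfSpace_re_gt _).inter (convex_ball _ _)).inter (convex_halfSpace_im_gt 0)
  have hz0 : (2 + Complex.I : ℂ) ∈ V := by
    refine ⟨⟨by simp; norm_num, ?_⟩, by simp⟩
    rw [mem_ball_zero_iff, ← sq_lt_sq₀ (norm_nonneg _) (by norm_num), ← Complex.normSq_eq_norm_sq]
    simp [Complex.normSq_apply]
    norm_num
  have hf : DifferentiableOn ℂ (hurwitzZeta a) (midpointRegion ∩ {1}ᶜ) := fun s hs ↦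
    (differentiableAt_hurwitzZeta a hs.2).differentiableWithinAt
  have hg := differentiableOn_midpointZeta ha
  have heq : Set.EqOn (hurwitzZeta a) (midpointZeta a) V := by
    refine ((hf.mono hVsub).analyticOnNhd hVopen).eqOn_of_preconnected_of_eventuallyEq
      ((hg.mono hVsub).analyticOnNhd hVopen) hVconv.isPreconnected hz0 ?_
    have h1 : ∀ᶠ s : ℂ in 𝓝 (2 + Complex.I), 1 < s.re :=
      (isOpen_lt continuous_const Complex.continuous_re).mem_nhds (by simp)
    filter_upwards [h1, hVopen.mem_nhds hz0] with s hs hsV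
    exact hurwitzZeta_eq_midpointZeta_of_one_lt_re ha ha' hs hsV.1
  have hmem : (σ : ℂ) ∈ midpointRegion ∩ {1}ᶜ := by
    refine ⟨⟨by simp; linarith, ?_⟩, ?_⟩
    · rw [mem_ball_zero_iff, Complex.norm_real, Real.norm_of_nonneg hσ]
      linarith
    · intro h
      exact hσ'.ne (by exact_mod_cast Set.mem_singleton_iff.1 h)
  have hpath : Tendsto (fun t : ℝ ↦ (σ : ℂ) + t * Complex.I) (𝓝[>] 0) (𝓝 (σ : ℂ)) := by
    have : Continuous (fun t : ℝ ↦ (σ : ℂ) + t * Complex.I) := by fun_prop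
    simpa using (this.tendsto 0).mono_left nhdsWithin_le_nhds
  have hV' : ∀ᶠ t : ℝ in 𝓝[>] 0, (σ : ℂ) + t * Complex.I ∈ V := by
    filter_upwards [hpath.eventually (isOpen_midpointRegion.mem_nhds hmem.1),
      self_mem_nhdsWithin] with t h1 h2
    exact ⟨h1, by simpa using h2⟩
  have hf' := ((hf.differentiableAt (hopen.mem_nhds hmem)).continuousAt.tendsto).comp hpath
  have hg' := ((hg.differentiableAt (hopen.mem_nhds hmem)).continuousAt.tendsto).comp hpath
  refine tendsto_nhds_unique_of_eventuallyEq hf' hg' ?_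
  filter_upwards [hV'] with t ht using heq ht

lemma hurwitzZeta_apply_zero {a : ℝ} (ha : 0 < a) (ha' : a ≤ 1) :
    hurwitzZeta a 0 = ((1 / 2 - a : ℝ) : ℂ) := by
  have := hurwitzZeta_ofReal_eq_midpointZeta ha ha' le_rfl zero_lt_one
  simp only [Complex.ofReal_zero] at this
  rw [this, midpointZeta]
  simp [midpointError_zero]
  ring

lemma exists_hurwitzZeta_eq_ofReal_le {a : ℝ} (ha : 0 < a) (ha' : a ≤ 1) {σ : ℝ}
    (hσ : 0 ≤ σ) (hσ' : σ < 1) : ∃ r : ℝ, hurwitzZeta a (σ : ℂ) = r ∧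
      r ≤ a ^ (-σ) - (a + 1 / 2) ^ (1 - σ) / (1 - σ) := by
  have h (n : ℕ) : ∃ r : ℝ, r ≤ 0 ∧ midpointError (n + 1 + a) σ = r :=
    midpointError_ofReal (by have : (0 : ℝ) ≤ n := n.cast_nonneg
                             linarith) hσ hσ'
  choose r hr hr' using h
  refine ⟨a ^ (-σ) + ∑' n, r n - (a + 1 / 2) ^ (1 - σ) / (1 - σ), ?_, ?_⟩
  · rw [hurwitzZeta_ofReal_eq_midpointZeta ha ha' hσ hσ', midpointZeta]
    simp_rw [hr']
    push_cast [Complex.ofReal_cpow ha.le, Complex.ofReal_cpow (by linarith : 0 ≤ a + 1 / 2)]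
    rfl
  · have : ∑' n, r n ≤ 0 := tsum_nonpos hr
    linarith

theorem hurwitzZeta_real_zeros_iff (a : ℝ) (ha : 0 < a) (ha' : a ≤ 1) :
    (∀ σ : ℝ, 0 < σ → σ < 1 → hurwitzZeta (a : UnitAddCircle) (σ : ℂ) ≠ 0) ↔ 1 / 2 ≤ a := by
  constructor
  · intro h
    by_contra! hlt
    have hcont : ContinuousOn (fun σ : ℝ ↦ (hurwitzZeta a (σ : ℂ)).re) (Set.Icc 0 (1 - a / 4)) := by
      intro σ hσ
      have hne : (σ : ℂ) ≠ 1 := by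
        have : σ ≠ 1 := by linarith [hσ.2]
        exact_mod_cast this
      exact (Complex.continuous_re.continuousAt.comp
        ((differentiableAt_hurwitzZeta a hne).continuousAt.comp
          Complex.continuous_ofReal.continuousAt)).continuousWithinAt
    have h0 : 0 < (hurwitzZeta a ((0 : ℝ) : ℂ)).re := by
      rw [Complex.ofReal_zero, hurwitzZeta_apply_zero ha ha', Complex.ofReal_re]
      linarith
    have h1 : (hurwitzZeta a ((1 - a / 4 : ℝ) : ℂ)).re < 0 := by
      obtain ⟨r, hr, hle⟩ := exists_hurwitzZeta_eq_ofReal_le ha ha' (σ := 1 - a / 4)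
        (by linarith) (by linarith)
      rw [hr, Complex.ofReal_re]
      refine hle.trans_lt ?_
      have b1 : a ^ (-(1 - a / 4)) ≤ a⁻¹ := by
        rw [← Real.rpow_neg_one]
        exact Real.rpow_le_rpow_of_exponent_ge ha ha' (by linarith)
      have b2 : 1 / 2 ≤ (a + 1 / 2) ^ (1 - (1 - a / 4)) := by
        calc (1 / 2 : ℝ) ≤ (a + 1 / 2) ^ (1 : ℝ) := by rw [Real.rpow_one]; linarith
          _ ≤ _ := Real.rpow_le_rpow_of_exponent_ge (by linarith) (by linarith) (by linarith)
      have b3 : 2 * a⁻¹ ≤ (a + 1 / 2) ^ (1 - (1 - a / 4)) / (1 - (1 - a / 4)) := by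
        rw [le_div_iff₀ (by linarith)]
        refine le_trans (le_of_eq ?_) b2
        field_simp
        ring
      have : 0 < a⁻¹ := inv_pos.2 ha
      linarith
    obtain ⟨σ, hσ, hz⟩ := intermediate_value_Icc' (by linarith) hcont ⟨h1.le, h0.le⟩
    have hσ0 : σ ≠ 0 := by
      rintro rfl
      exact h0.ne' hz
    refine h σ (lt_of_le_of_ne hσ.1 hσ0.symm) (by linarith [hσ.2]) ?_
    obtain ⟨r, hr, -⟩ := exists_hurwitzZeta_eq_ofReal_le ha ha' hσ.1 (by linarith [hσ.2])
    simp only [hr, Complex.ofReal_re] at hz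
    rw [hr, hz, Complex.ofReal_zero]
  · intro hhalf σ hσ hσ' hz
    obtain ⟨r, hr, hle⟩ := exists_hurwitzZeta_eq_ofReal_le ha ha' hσ.le hσ'
    have hr0 : r = 0 := by exact_mod_cast hr.symm.trans hz
    have b1 : a ^ (-σ) ≤ 1 + σ := by
      calc a ^ (-σ) ≤ (1 / 2) ^ (-σ) :=
            Real.rpow_le_rpow_of_nonpos (by norm_num) hhalf (by linarith)
        _ = (1 + 1) ^ σ := by
            rw [Real.rpow_neg (by norm_num), ← Real.inv_rpow (by norm_num)]; norm_num
        _ ≤ 1 + σ * 1 := rpow_one_add_le_one_add_mul_self (by norm_num) hσ.le hσ'.le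
        _ = 1 + σ := by ring
    have b2 : 1 ≤ (a + 1 / 2) ^ (1 - σ) := Real.one_le_rpow (by linarith) (by linarith)
    have b3 : 1 + σ < (a + 1 / 2) ^ (1 - σ) / (1 - σ) := by
      rw [lt_div_iff₀ (by linarith)]
      nlinarith
    linarith
end

section
/- Let 0 < a < 1/2. Then there exists a real number σ with 0 < σ < 1 such that ζ(σ,a) = 0. -/
open HurwitzZeta

open Set Filter Topology MeasureTheory Asymptotics

/-- The function whose Mellin transform is `Γ(s) (ζ(s, a) - ζ(s))`. -/
noncomputable def hurwitzKernel (a t : ℝ) : ℝ :=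
  (Real.exp (-a * t) - Real.exp (-t)) / (1 - Real.exp (-t))

lemma one_sub_exp_neg_pos {t : ℝ} (ht : 0 < t) : 0 < 1 - Real.exp (-t) := by
  have : Real.exp (-t) < 1 := by simpa using ht
  linarith

lemma hurwitzKernel_nonneg {a t : ℝ} (ha : a ≤ 1) (ht : 0 < t) : 0 ≤ hurwitzKernel a t := by
  refine div_nonneg (sub_nonneg.mpr (Real.exp_le_exp.mpr ?_)) (one_sub_exp_neg_pos ht).le
  nlinarith

lemma hurwitzKernel_le_exp {a t : ℝ} (ha : 0 ≤ a) (ht : 0 < t) :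
    hurwitzKernel a t ≤ Real.exp (-a * t) := by
  rw [hurwitzKernel, div_le_iff₀ (one_sub_exp_neg_pos ht)]
  have h : Real.exp (-a * t) ≤ 1 := Real.exp_le_one_iff.mpr (by nlinarith)
  nlinarith [Real.exp_pos (-t)]

lemma mul_exp_neg_le_hurwitzKernel {a t : ℝ} (ha : a ≤ 1) (ht : 0 < t) :
    (1 - a) * Real.exp (-t) ≤ hurwitzKernel a t := by
  rw [hurwitzKernel, le_div_iff₀ (one_sub_exp_neg_pos ht)]
  have h₁ : Real.exp (-a * t) = Real.exp ((1 - a) * t) * Real.exp (-t) := by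
    rw [← Real.exp_add]; ring_nf
  have h₂ := Real.add_one_le_exp ((1 - a) * t)
  have h₃ : 1 - Real.exp (-t) ≤ t := by linarith [Real.add_one_le_exp (-t)]
  have h₄ := mul_le_mul_of_nonneg_left h₃ (sub_nonneg.mpr ha)
  rw [h₁]
  nlinarith [Real.exp_pos (-t)]

lemma continuousOn_hurwitzKernel (a : ℝ) : ContinuousOn (hurwitzKernel a) (Ioi 0) := by
  unfold hurwitzKernel
  refine ContinuousOn.div (by fun_prop) (by fun_prop) fun t ht ↦ (one_sub_exp_neg_pos ht).ne'

lemma locallyIntegrableOn_hurwitzKernel (a : ℝ) :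
    LocallyIntegrableOn (fun t ↦ (hurwitzKernel a t : ℂ)) (Ioi 0) :=
  (Complex.continuous_ofReal.comp_continuousOn
    (continuousOn_hurwitzKernel a)).locallyIntegrableOn measurableSet_Ioi

lemma norm_hurwitzKernel_le {a t : ℝ} (ha : 0 ≤ a) (ha' : a ≤ 1) (ht : 0 < t) :
    ‖(hurwitzKernel a t : ℂ)‖ ≤ Real.exp (-a * t) := by
  rw [Complex.norm_real, Real.norm_of_nonneg (hurwitzKernel_nonneg ha' ht)]
  exact hurwitzKernel_le_exp ha ht

lemma isBigO_atTop_hurwitzKernel {a : ℝ} (ha : 0 ≤ a) (ha' : a ≤ 1) :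
    (fun t ↦ (hurwitzKernel a t : ℂ)) =O[atTop] fun t ↦ Real.exp (-a * t) := by
  refine IsBigO.of_bound 1 ?_
  filter_upwards [eventually_gt_atTop 0] with t ht
  simpa using norm_hurwitzKernel_le ha ha' ht

lemma isBigO_nhdsGT_zero_hurwitzKernel {a : ℝ} (ha : 0 ≤ a) (ha' : a ≤ 1) :
    (fun t ↦ (hurwitzKernel a t : ℂ)) =O[𝓝[>] 0] fun t : ℝ ↦ t ^ (-(0 : ℝ)) := by
  refine IsBigO.of_bound 1 ?_
  filter_upwards [self_mem_nhdsWithin] with t ht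
  have ht : 0 < t := ht
  have h : Real.exp (-a * t) ≤ 1 := Real.exp_le_one_iff.mpr (by nlinarith)
  simpa using (norm_hurwitzKernel_le ha ha' ht).trans h

lemma mellinConvergent_hurwitzKernel {a : ℝ} (ha : 0 < a) (ha' : a ≤ 1) {s : ℂ} (hs : 0 < s.re) :
    MellinConvergent (fun t ↦ (hurwitzKernel a t : ℂ)) s :=
  mellinConvergent_of_isBigO_rpow_exp ha (locallyIntegrableOn_hurwitzKernel a)
    (isBigO_atTop_hurwitzKernel ha.le ha') (isBigO_nhdsGT_zero_hurwitzKernel ha.le ha') hs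

lemma differentiableAt_mellin_hurwitzKernel {a : ℝ} (ha : 0 < a) (ha' : a ≤ 1) {s : ℂ}
    (hs : 0 < s.re) : DifferentiableAt ℂ (mellin fun t ↦ (hurwitzKernel a t : ℂ)) s :=
  mellin_differentiableAt_of_isBigO_rpow_exp ha (locallyIntegrableOn_hurwitzKernel a)
    (isBigO_atTop_hurwitzKernel ha.le ha') (isBigO_nhdsGT_zero_hurwitzKernel ha.le ha') hs

lemma summable_one_div_add_rpow {b : ℝ} (hb : 0 < b) (hb' : b ≤ 1) {s : ℂ} (hs : 1 < s.re) :
    Summable fun n : ℕ ↦ 1 / ((n : ℝ) + b) ^ s.re := by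
  refine (hasSum_hurwitzZeta_of_one_lt_re ⟨hb.le, hb'⟩ hs).summable.norm.congr fun n ↦ ?_
  rw [norm_div, norm_one, ← Complex.ofReal_natCast, ← Complex.ofReal_add,
    Complex.norm_cpow_eq_rpow_re_of_pos (by positivity)]

lemma hasSum_exp_neg_add_mul (b : ℝ) {t : ℝ} (ht : 0 < t) :
    HasSum (fun n : ℕ ↦ Real.exp (-((n : ℝ) + b) * t))
      (Real.exp (-b * t) / (1 - Real.exp (-t))) := by
  have h := (hasSum_geometric_of_lt_one (Real.exp_pos (-t)).le
    (by simpa using ht)).mul_left (Real.exp (-b * t))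
  rw [← div_eq_mul_inv] at h
  refine h.congr_fun fun n ↦ ?_
  rw [← Real.exp_nat_mul, ← Real.exp_add]
  ring_nf

lemma Gamma_mul_hurwitzZeta_sub_of_one_lt_re {a : ℝ} (ha : 0 < a) (ha' : a ≤ 1) {s : ℂ}
    (hs : 1 < s.re) :
    Complex.Gamma s * (hurwitzZeta (a : UnitAddCircle) s - riemannZeta s) =
      mellin (fun t ↦ (hurwitzKernel a t : ℂ)) s := by
  have key := hasSum_mellin (ι := ℕ ⊕ ℕ) (a := Sum.elim (fun _ ↦ 1) (fun _ ↦ -1))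
    (p := Sum.elim (fun n ↦ (n : ℝ) + a) (fun n ↦ (n : ℝ) + 1))
    (F := fun t ↦ (hurwitzKernel a t : ℂ)) (s := s) ?_ (by linarith) ?_ ?_
  · refine HasSum.unique ?_ key
    rw [mul_sub, sub_eq_add_neg]
    refine HasSum.sum ?_ ?_
    · refine ((hasSum_hurwitzZeta_of_one_lt_re ⟨ha.le, ha'⟩ hs).mul_left
        (Complex.Gamma s)).congr_fun fun n ↦ ?_
      simp [div_eq_mul_inv]
    · have h := (hasSum_hurwitzZeta_of_one_lt_re (a := 1) (by simp) hs).mul_left (Complex.Gamma s)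
      rw [AddCircle.coe_period, hurwitzZeta_zero] at h
      refine h.neg.congr_fun fun n ↦ ?_
      simp [div_eq_mul_inv]
  · rintro (n | n) <;> right <;> simp <;> positivity
  · intro t ht
    have h₁ := Complex.hasSum_ofReal.mpr (hasSum_exp_neg_add_mul a ht)
    have h₂ := Complex.hasSum_ofReal.mpr (hasSum_exp_neg_add_mul 1 ht).neg
    have h₃ : (hurwitzKernel a t : ℂ) = ((Real.exp (-a * t) / (1 - Real.exp (-t)) : ℝ) : ℂ) +
        ((-(Real.exp (-1 * t) / (1 - Real.exp (-t))) : ℝ) : ℂ) := by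
      rw [← Complex.ofReal_add, hurwitzKernel, neg_one_mul]
      congr 1
      ring
    rw [h₃]
    refine HasSum.sum ?_ ?_
    · exact h₁.congr_fun fun n ↦ by simp [-neg_add_rev]
    · exact h₂.congr_fun fun n ↦ by simp [-neg_add_rev]
  · refine (HasSum.sum
      ((summable_one_div_add_rpow ha ha' hs).hasSum.congr_fun fun n ↦ ?_)
      ((summable_one_div_add_rpow one_pos le_rfl hs).hasSum.congr_fun fun n ↦ ?_)).summable
    · simp
    · simp

lemma Gamma_mul_hurwitzZeta_sub {a : ℝ} (ha : 0 < a) (ha' : a ≤ 1) {s : ℂ} (hs : 0 < s.re) :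
    Complex.Gamma s * (hurwitzZeta (a : UnitAddCircle) s - riemannZeta s) =
      mellin (fun t ↦ (hurwitzKernel a t : ℂ)) s := by
  have hopen : IsOpen {z : ℂ | 0 < z.re} := isOpen_lt continuous_const Complex.continuous_re
  have hΓ : DifferentiableOn ℂ Complex.Gamma {z : ℂ | 0 < z.re} := fun z hz ↦
    (Complex.differentiableAt_Gamma z fun m h ↦ by
      have hz : 0 < z.re := hz
      rw [h, Complex.neg_re, Complex.natCast_re] at hz
      linarith [(Nat.cast_nonneg m : (0 : ℝ) ≤ m)]).differentiableWithinAt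
  have hD := (differentiable_hurwitzZeta_sub_hurwitzZeta a 0).differentiableOn
    (s := {z : ℂ | 0 < z.re})
  rw [hurwitzZeta_zero] at hD
  refine AnalyticOnNhd.eqOn_of_preconnected_of_eventuallyEq (z₀ := 2)
    ((hΓ.mul hD).analyticOnNhd hopen)
    (DifferentiableOn.analyticOnNhd (fun z hz ↦
      (differentiableAt_mellin_hurwitzKernel ha ha' hz).differentiableWithinAt) hopen)
    (convex_halfSpace_re_gt 0).isPreconnected (by simp) ?_ hs
  filter_upwards [(isOpen_lt continuous_const Complex.continuous_re).mem_nhds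
    (show (1 : ℝ) < (2 : ℂ).re by norm_num)] with z hz
  exact Gamma_mul_hurwitzZeta_sub_of_one_lt_re ha ha' hz

lemma mellin_hurwitzKernel_ofReal (a σ : ℝ) :
    mellin (fun t ↦ (hurwitzKernel a t : ℂ)) σ =
      ((∫ t in Ioi (0 : ℝ), t ^ (σ - 1) * hurwitzKernel a t : ℝ) : ℂ) := by
  rw [mellin, ← integral_complex_ofReal]
  refine setIntegral_congr_fun measurableSet_Ioi fun t ht ↦ ?_
  have ht : 0 < t := ht
  simp [Complex.ofReal_cpow ht.le]

lemma hurwitzZeta_ofReal_eq {a : ℝ} (ha : 0 < a) (ha' : a ≤ 1) {σ : ℝ} (hσ : 0 < σ) :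
    hurwitzZeta (a : UnitAddCircle) (σ : ℂ) = riemannZeta σ +
      (((∫ t in Ioi (0 : ℝ), t ^ (σ - 1) * hurwitzKernel a t) / Real.Gamma σ : ℝ) : ℂ) := by
  have h := Gamma_mul_hurwitzZeta_sub ha ha' (s := σ) (by simpa using hσ)
  rw [mellin_hurwitzKernel_ofReal, Complex.Gamma_ofReal] at h
  have hΓ : (Real.Gamma σ : ℂ) ≠ 0 := by exact_mod_cast (Real.Gamma_pos_of_pos hσ).ne'
  rw [Complex.ofReal_div, ← h]
  field_simp
  ring

lemma hurwitzZeta_ofReal_im {a : ℝ} (ha : 0 < a) (ha' : a ≤ 1) {σ : ℝ} (hσ : 0 < σ) :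
    (hurwitzZeta (a : UnitAddCircle) (σ : ℂ)).im = 0 := by
  rw [hurwitzZeta_ofReal_eq ha ha' hσ, Complex.add_im, Complex.ofReal_im, add_zero,
    ← Complex.conj_eq_iff_im, ← riemannZeta_conj, Complex.conj_ofReal]

lemma riemannZeta_re_add_le_hurwitzZeta_re {a : ℝ} (ha : 0 < a) (ha' : a ≤ 1) {σ : ℝ}
    (hσ : 0 < σ) :
    (riemannZeta σ).re + (1 - a) ≤ (hurwitzZeta (a : UnitAddCircle) (σ : ℂ)).re := by
  rw [hurwitzZeta_ofReal_eq ha ha' hσ, Complex.add_re, Complex.ofReal_re,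
    add_le_add_iff_left, le_div_iff₀ (Real.Gamma_pos_of_pos hσ), Real.Gamma_eq_integral hσ,
    ← integral_const_mul]
  refine setIntegral_mono_on ((Real.GammaIntegral_convergent hσ).const_mul _) ?_
    measurableSet_Ioi fun t ht ↦ ?_
  · have h := (mellinConvergent_hurwitzKernel ha ha' (s := σ) (by simpa using hσ)).re
    refine IntegrableOn.congr_fun h (fun t ht ↦ ?_) measurableSet_Ioi
    have ht : 0 < t := ht
    have h' : (t : ℂ) ^ ((σ : ℂ) - 1) = ((t ^ (σ - 1) : ℝ) : ℂ) := by
      simp [Complex.ofReal_cpow ht.le]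
    simp [h']
  · have ht : 0 < t := ht
    have := mul_le_mul_of_nonneg_left (mul_exp_neg_le_hurwitzKernel ha' ht)
      (Real.rpow_nonneg ht.le (σ - 1))
    linarith

lemma exists_hurwitzZeta_re_neg (a : UnitAddCircle) {x : ℝ} (hx : x < 1) :
    ∃ σ ∈ Ioo x 1, (hurwitzZeta a (σ : ℂ)).re < 0 := by
  have hmap : Tendsto (fun σ : ℝ ↦ (σ : ℂ)) (𝓝[<] 1) (𝓝[≠] 1) := by
    refine tendsto_nhdsWithin_iff.mpr ⟨?_, ?_⟩
    · exact (Complex.continuous_ofReal.tendsto' 1 1 (by simp)).mono_left nhdsWithin_le_nhds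
    · filter_upwards [self_mem_nhdsWithin] with σ hσ
      have hσ : σ < 1 := hσ
      simpa using hσ.ne
  have h := (Complex.continuous_re.tendsto 1).comp ((hurwitzZeta_residue_one a).comp hmap)
  have hpos := h.eventually (lt_mem_nhds (show (0 : ℝ) < (1 : ℂ).re by simp))
  obtain ⟨σ, hσ, hmem⟩ := (hpos.and (Ioo_mem_nhdsLT hx)).exists
  refine ⟨σ, hmem, ?_⟩
  have h' : 0 < (σ - 1) * (hurwitzZeta a (σ : ℂ)).re := by
    simpa using hσ
  nlinarith [hmem.2]

lemma exists_hurwitzZeta_re_pos {a : ℝ} (ha : 0 < a) (ha' : a < 1 / 2) :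
    ∃ σ ∈ Ioo (0 : ℝ) 1, 0 < (hurwitzZeta (a : UnitAddCircle) (σ : ℂ)).re := by
  have hcont : ContinuousAt (fun σ : ℝ ↦ (riemannZeta σ).re) 0 :=
    Complex.continuous_re.continuousAt.comp (ContinuousAt.comp
      (Complex.ofReal_zero ▸ (differentiableAt_riemannZeta zero_ne_one).continuousAt)
      Complex.continuous_ofReal.continuousAt)
  have hlim : Tendsto (fun σ : ℝ ↦ (riemannZeta σ).re) (𝓝[>] 0) (𝓝 (-1 / 2)) := by
    have h : Tendsto _ _ (𝓝 (riemannZeta ((0 : ℝ) : ℂ)).re) := hcont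
    have h0 : (riemannZeta ((0 : ℝ) : ℂ)).re = -1 / 2 := by
      rw [Complex.ofReal_zero, riemannZeta_zero]
      norm_num
    rw [h0] at h
    exact h.mono_left nhdsWithin_le_nhds
  obtain ⟨σ, hσ, hmem⟩ := ((hlim.eventually (lt_mem_nhds
    (show a - 1 < -1 / 2 by linarith))).and (Ioo_mem_nhdsGT one_pos)).exists
  refine ⟨σ, hmem, ?_⟩
  linarith [riemannZeta_re_add_le_hurwitzZeta_re ha (by linarith) hmem.1]

theorem hurwitzZeta_exists_real_zero (a : ℝ) (ha : 0 < a) (ha' : a < 1 / 2) :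
    ∃ σ : ℝ, 0 < σ ∧ σ < 1 ∧ hurwitzZeta (a : UnitAddCircle) (σ : ℂ) = 0 := by
  obtain ⟨x, ⟨hx0, hx1⟩, hx⟩ := exists_hurwitzZeta_re_pos ha ha'
  obtain ⟨y, ⟨hxy, hy1⟩, hy⟩ := exists_hurwitzZeta_re_neg (a : UnitAddCircle) hx1
  have hcont : ContinuousOn (fun σ : ℝ ↦ (hurwitzZeta (a : UnitAddCircle) (σ : ℂ)).re)
      (Icc x y) := fun σ hσ ↦ by
    have hne : (σ : ℂ) ≠ 1 := by exact_mod_cast (hσ.2.trans_lt hy1).ne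
    exact (Complex.continuous_re.continuousAt.comp (ContinuousAt.comp
      (differentiableAt_hurwitzZeta _ hne).continuousAt
      Complex.continuous_ofReal.continuousAt)).continuousWithinAt
  obtain ⟨σ, hσ, h0⟩ := intermediate_value_Icc' hxy.le hcont ⟨hy.le, hx.le⟩
  have hσ0 : 0 < σ := hx0.trans_le hσ.1
  exact ⟨σ, hσ0, hσ.2.trans_lt hy1,
    Complex.ext h0 (hurwitzZeta_ofReal_im ha (by linarith) hσ0)⟩
end

section
/- Let 0 < a ≤ 1 and let s₁, s₂ ∈ ℂ with 0 < Re(s₁) < 1, Re(s₂) > 1 and Re(s₁ + s₂) > 2. Then Γ(s₁) Γ(s₂) ζ₂(s₁,s₂;a) = ∫_0^∞ (y^{s₂-1}/(e^y − 1)) ∫_0^∞ H(a,x+y) x^{s₁-1} dx dy + Γ(s₁) Γ(1−s₁) ∫_0^∞ y^{s₁+s₂−2}/(e^y − 1) dy, where the first double integral converges absolutely. -/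
open Set

/-- `H(a,x) = e^((1-a)x)/(e^x - 1) - 1/x`. -/
noncomputable def Hfun (a x : ℝ) : ℝ :=
  Real.exp ((1 - a) * x) / (Real.exp x - 1) - 1 / x

/-- The Hurwitz type Euler–Zagier double zeta series
`∑_{0 ≤ n₁ < n₂} (n₁+a)^(-s₁) (n₂+a)^(-s₂)`. -/
noncomputable def doubleZeta (a : ℝ) (s₁ s₂ : ℂ) : ℂ :=
  ∑' p : {q : ℕ × ℕ // q.1 < q.2},
    ((p.val.1 : ℂ) + a) ^ (-s₁) * ((p.val.2 : ℂ) + a) ^ (-s₂)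

open MeasureTheory

/-- `e^((1-a)x)/(e^x - 1) ≤ (1 + 1/a)/x` for `x > 0`. -/
lemma exp_div_exp_sub_one_le {a x : ℝ} (ha : 0 < a) (hx : 0 < x) :
    Real.exp ((1 - a) * x) / (Real.exp x - 1) ≤ (1 + 1 / a) * (1 / x) := by
  have h1 : 1 + x ≤ Real.exp x := by linarith [Real.add_one_le_exp x]
  have h2 : 1 + a * x ≤ Real.exp (a * x) := by linarith [Real.add_one_le_exp (a * x)]
  have h3 : Real.exp ((1 - a) * x) * Real.exp (a * x) = Real.exp x := by
    rw [← Real.exp_add]; ring_nf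
  have hax : 0 < a * x := mul_pos ha hx
  have h4 : Real.exp ((1 - a) * x) * (1 + a * x) ≤ Real.exp x := by
    rw [← h3]; gcongr
  have hE : 0 < Real.exp ((1 - a) * x) := Real.exp_pos _
  have h5 : Real.exp ((1 - a) * x) * (a * x) * (1 + x) ≤ (a + 1) * x * Real.exp x := by
    have : Real.exp ((1 - a) * x) * (a * x) * (1 + x)
        ≤ (a + 1) * x * (Real.exp ((1 - a) * x) * (1 + a * x)) := by
      have : 0 ≤ Real.exp ((1 - a) * x) * x * (1 + a * a * x) := by positivity
      nlinarith
    exact this.trans (by gcongr)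
  have h6 : x * Real.exp x ≤ (1 + x) * (Real.exp x - 1) := by nlinarith
  have h7 : Real.exp ((1 - a) * x) * (a * x) ≤ (a + 1) * (Real.exp x - 1) := by
    have : Real.exp ((1 - a) * x) * (a * x) * (1 + x)
        ≤ (a + 1) * (Real.exp x - 1) * (1 + x) := by nlinarith
    exact le_of_mul_le_mul_right this (by linarith)
  rw [div_le_iff₀ (by linarith)]
  have : (1 + 1 / a) * (1 / x) * (Real.exp x - 1) = (a + 1) * (Real.exp x - 1) / (a * x) := by
    field_simp
  rw [this, le_div_iff₀ hax]
  exact h7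

lemma one_div_exp_sub_one_le {y : ℝ} (hy : 0 < y) :
    1 / (Real.exp y - 1) ≤ Real.exp (-y) * (1 + 1 / y) := by
  have h1 : 1 + y ≤ Real.exp y := by linarith [Real.add_one_le_exp y]
  rw [div_le_iff₀ (by linarith), Real.exp_neg]
  have : (Real.exp y)⁻¹ * (1 + 1 / y) * (Real.exp y - 1)
      = (1 + y) * (Real.exp y - 1) / (y * Real.exp y) := by
    field_simp
    ring
  rw [this, le_div_iff₀ (by positivity)]
  nlinarith

lemma integrableOn_rpow_div_exp_sub_one {σ : ℝ} (hσ : 1 < σ) :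
    IntegrableOn (fun y : ℝ => y ^ (σ - 1) / (Real.exp y - 1)) (Ioi 0) := by
  have h1 := Real.GammaIntegral_convergent (s := σ) (by linarith)
  have h2 := Real.GammaIntegral_convergent (s := σ - 1) (by linarith)
  refine Integrable.mono' (h1.add h2) (Measurable.aestronglyMeasurable (by fun_prop)) ?_
  filter_upwards [ae_restrict_mem measurableSet_Ioi] with y hy
  have hy : 0 < y := hy
  have he : 0 < Real.exp y - 1 := by linarith [Real.add_one_lt_exp hy.ne']
  rw [Real.norm_of_nonneg (by positivity), div_eq_mul_one_div]
  refine (mul_le_mul_of_nonneg_left (one_div_exp_sub_one_le hy) (by positivity)).trans_eq ?_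
  simp only [Pi.add_apply, Real.rpow_sub_one hy.ne']
  field_simp

lemma integrable_cpow_mul_exp {s : ℂ} {r : ℝ} (hs : 0 < s.re) (hr : 0 < r) :
    IntegrableOn (fun t : ℝ => (t : ℂ) ^ (s - 1) * (Real.exp (-(r * t)) : ℂ)) (Ioi 0) := by
  have h := integrableOn_rpow_mul_exp_neg_mul_rpow (s := s.re - 1) (p := 1) (b := r)
    (by linarith) one_pos hr
  refine Integrable.mono' h (by fun_prop) ?_
  filter_upwards [ae_restrict_mem measurableSet_Ioi] with t ht
  rw [norm_mul, Complex.norm_cpow_eq_rpow_re_of_pos ht, Complex.norm_real,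
    Real.norm_of_nonneg (Real.exp_pos _).le]
  simp

lemma integral_cpow_mul_ofReal_exp {s : ℂ} {r : ℝ} (hs : 0 < s.re) (hr : 0 < r) :
    ∫ t : ℝ in Ioi 0, (t : ℂ) ^ (s - 1) * (Real.exp (-(r * t)) : ℂ)
      = Complex.Gamma s * (r : ℂ) ^ (-s) := by
  have := Complex.integral_cpow_mul_exp_neg_mul_Ioi hs hr
  rw [one_div, Complex.inv_cpow _ _ (Complex.arg_ofReal_of_nonneg hr.le ▸ Real.pi_pos.ne),
    ← Complex.cpow_neg, mul_comm] at this
  rw [← this]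
  simp

lemma integral_exp_neg_mul_Ioi_zero {c : ℝ} (hc : 0 < c) :
    ∫ t : ℝ in Ioi 0, Real.exp (-(c * t)) = 1 / c := by
  have := integral_exp_mul_Ioi (a := -c) (by linarith) 0
  simpa using this

/-- The integrand `x^(s-1) e^(-t(x+y))` whose two iterated integrals evaluate
`∫ x^(s-1)/(x+y) dx`. -/
lemma integrable_cpow_mul_exp_prod {s : ℂ} {y : ℝ} (hs : 0 < s.re) (hs' : s.re < 1) (hy : 0 < y) :
    Integrable (fun p : ℝ × ℝ => (p.1 : ℂ) ^ (s - 1) * (Real.exp (-((p.1 + y) * p.2)) : ℂ))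
      ((volume.restrict (Ioi 0)).prod (volume.restrict (Ioi 0))) := by
  refine (integrable_prod_iff' (by fun_prop)).2 ⟨?_, ?_⟩
  · filter_upwards [ae_restrict_mem measurableSet_Ioi] with t ht
    refine ((integrable_cpow_mul_exp hs ht).mul_const (Real.exp (-(y * t)) : ℂ)).congr ?_
    refine .of_forall fun x => ?_
    simp only
    rw [mul_assoc, ← Complex.ofReal_mul, ← Real.exp_add]
    ring_nf
  · have h := integrableOn_rpow_mul_exp_neg_mul_rpow (s := -s.re) (p := 1) (b := y)
      (by linarith) one_pos hy
    refine (h.const_mul (Real.Gamma s.re)).congr ?_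
    filter_upwards [ae_restrict_mem measurableSet_Ioi] with t ht
    have ht : 0 < t := ht
    have h1 := Real.integral_rpow_mul_exp_neg_mul_Ioi hs ht
    have h2 : ∫ x in Ioi (0 : ℝ), ‖(x : ℂ) ^ (s - 1) * (Real.exp (-((x + y) * t)) : ℂ)‖
        = ∫ x in Ioi (0 : ℝ), x ^ (s.re - 1) * Real.exp (-(t * x)) * Real.exp (-(y * t)) := by
      refine setIntegral_congr_fun measurableSet_Ioi fun x hx => ?_
      rw [norm_mul, Complex.norm_cpow_eq_rpow_re_of_pos hx, Complex.norm_real,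
        Real.norm_of_nonneg (Real.exp_pos _).le, mul_assoc, ← Real.exp_add]
      simp only [Complex.sub_re, Complex.one_re]
      ring_nf
    rw [h2, integral_mul_const, h1, one_div, Real.inv_rpow ht.le, Real.rpow_neg ht.le]
    simp only [Real.rpow_one, neg_mul]
    ring

lemma integrable_cpow_mul_one_div_add {s : ℂ} {y : ℝ} (hs : 0 < s.re) (hs' : s.re < 1)
    (hy : 0 < y) :
    IntegrableOn (fun x : ℝ => (x : ℂ) ^ (s - 1) * ((1 / (x + y) : ℝ) : ℂ)) (Ioi 0) := by
  refine (integrable_cpow_mul_exp_prod hs hs' hy).integral_prod_left.congr ?_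
  filter_upwards [ae_restrict_mem measurableSet_Ioi] with x hx
  have hx : 0 < x := hx
  rw [integral_const_mul, integral_complex_ofReal, integral_exp_neg_mul_Ioi_zero (by positivity)]

lemma integral_cpow_mul_one_div_add {s : ℂ} {y : ℝ} (hs : 0 < s.re) (hs' : s.re < 1)
    (hy : 0 < y) :
    ∫ x : ℝ in Ioi 0, (x : ℂ) ^ (s - 1) * ((1 / (x + y) : ℝ) : ℂ)
      = Complex.Gamma s * Complex.Gamma (1 - s) * (y : ℂ) ^ (s - 1) := by
  calc _ = ∫ x : ℝ in Ioi 0, ∫ t : ℝ in Ioi 0,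
        (x : ℂ) ^ (s - 1) * (Real.exp (-((x + y) * t)) : ℂ) := by
        refine setIntegral_congr_fun measurableSet_Ioi fun x hx => ?_
        have hx : 0 < x := hx
        rw [integral_const_mul, integral_complex_ofReal,
          integral_exp_neg_mul_Ioi_zero (by positivity)]
    _ = ∫ t : ℝ in Ioi 0, ∫ x : ℝ in Ioi 0,
        (x : ℂ) ^ (s - 1) * (Real.exp (-((x + y) * t)) : ℂ) :=
      integral_integral_swap (integrable_cpow_mul_exp_prod hs hs' hy)
    _ = ∫ t : ℝ in Ioi 0,
        Complex.Gamma s * ((t : ℂ) ^ ((1 - s) - 1) * (Real.exp (-(y * t)) : ℂ)) := by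
      refine setIntegral_congr_fun measurableSet_Ioi fun t ht => ?_
      rw [show (1 - s) - 1 = -s by ring, ← mul_assoc, ← integral_cpow_mul_ofReal_exp hs ht,
        ← integral_mul_const]
      congr 1
      ext x
      rw [mul_assoc, ← Complex.ofReal_mul, ← Real.exp_add]
      ring_nf
    _ = _ := by
      rw [integral_const_mul, integral_cpow_mul_ofReal_exp (by simpa using hs') hy]
      ring_nf

lemma integral_rpow_mul_one_div_add {σ y : ℝ} (hs : 0 < σ) (hs' : σ < 1) (hy : 0 < y) :
    ∫ x : ℝ in Ioi 0, x ^ (σ - 1) * (1 / (x + y))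
      = Real.Gamma σ * Real.Gamma (1 - σ) * y ^ (σ - 1) := by
  have h := integral_cpow_mul_one_div_add (s := σ) (by simpa using hs) (by simpa using hs') hy
  rw [← Complex.ofReal_inj, ← integral_complex_ofReal]
  push_cast [← Complex.Gamma_ofReal, Complex.ofReal_cpow hy.le] at h ⊢
  rw [← h]
  refine setIntegral_congr_fun measurableSet_Ioi fun x hx => ?_
  rw [Complex.ofReal_cpow (le_of_lt hx)]
  push_cast
  rfl

/-- The dominating kernel `x^(s₁-1) y^(s₂-1) / ((e^y - 1) (x + y))` is integrable. -/
lemma integrable_kernel {s₁ s₂ : ℂ} (h1 : 0 < s₁.re) (h1' : s₁.re < 1)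
    (h12 : 2 < (s₁ + s₂).re) :
    Integrable
      (fun p : ℝ × ℝ => (p.2 : ℂ) ^ (s₂ - 1) / ((Real.exp p.2 : ℂ) - 1) *
        ((p.1 : ℂ) ^ (s₁ - 1) * ((1 / (p.1 + p.2) : ℝ) : ℂ)))
      ((volume.restrict (Ioi 0)).prod (volume.restrict (Ioi 0))) := by
  have hm : Measurable (fun p : ℝ × ℝ => (p.2 : ℂ) ^ (s₂ - 1) / ((Real.exp p.2 : ℂ) - 1) *
        ((p.1 : ℂ) ^ (s₁ - 1) * ((1 / (p.1 + p.2) : ℝ) : ℂ))) := by fun_prop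
  refine (integrable_prod_iff' hm.aestronglyMeasurable).2 ⟨?_, ?_⟩
  · filter_upwards [ae_restrict_mem measurableSet_Ioi] with y hy
    exact (integrable_cpow_mul_one_div_add h1 h1' hy).const_mul _
  · have h := integrableOn_rpow_div_exp_sub_one (σ := (s₁ + s₂).re - 1) (by linarith)
    refine (h.const_mul (Real.Gamma s₁.re * Real.Gamma (1 - s₁.re))).congr ?_
    filter_upwards [ae_restrict_mem measurableSet_Ioi] with y hy
    have hy : 0 < y := hy
    have he : 0 < Real.exp y - 1 := by linarith [Real.add_one_lt_exp hy.ne']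
    have h2 : ∫ x in Ioi (0 : ℝ), ‖(y : ℂ) ^ (s₂ - 1) / ((Real.exp y : ℂ) - 1) *
          ((x : ℂ) ^ (s₁ - 1) * ((1 / (x + y) : ℝ) : ℂ))‖
        = ∫ x in Ioi (0 : ℝ), y ^ (s₂.re - 1) / (Real.exp y - 1) *
          (x ^ (s₁.re - 1) * (1 / (x + y))) := by
      refine setIntegral_congr_fun measurableSet_Ioi fun x hx => ?_
      have hx : 0 < x := hx
      rw [norm_mul, norm_mul, norm_div, Complex.norm_cpow_eq_rpow_re_of_pos hx,
        Complex.norm_cpow_eq_rpow_re_of_pos hy, Complex.norm_real, ← Complex.ofReal_one,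
        ← Complex.ofReal_sub, Complex.norm_real, Real.norm_of_nonneg he.le,
        Real.norm_of_nonneg (by positivity : 0 ≤ 1 / (x + y))]
      simp
    rw [h2, integral_const_mul, integral_rpow_mul_one_div_add h1 h1' hy,
      show (s₁ + s₂).re - 1 - 1 = (s₂.re - 1) + (s₁.re - 1) by
        simp only [Complex.add_re]; ring, Real.rpow_add hy]
    ring

lemma hasSum_exp_neg_natCast_add_mul {b x : ℝ} (hx : 0 < x) :
    HasSum (fun m : ℕ => Real.exp (-((m + b) * x)))
      (Real.exp ((1 - b) * x) / (Real.exp x - 1)) := by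
  have h := (hasSum_geometric_of_lt_one (Real.exp_pos (-x)).le
    (Real.exp_lt_one_iff.2 (by linarith))).mul_left (Real.exp (-(b * x)))
  convert! h using 1
  · ext m
    rw [← Real.exp_nat_mul, ← Real.exp_add]
    ring_nf
  · have he : 0 < Real.exp x - 1 := by linarith [Real.add_one_lt_exp hx.ne']
    have : Real.exp ((1 - b) * x) = Real.exp (-(b * x)) * Real.exp x := by
      rw [← Real.exp_add]; ring_nf
    rw [this, mul_div_assoc]
    congr 1
    rw [Real.exp_neg]
    field_simp

lemma hasSum_exp_mul_exp {a x y : ℝ} (hx : 0 < x) (hy : 0 < y) :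
    HasSum (fun p : ℕ × ℕ =>
        Real.exp (-((p.1 + a) * x)) * Real.exp (-(((p.1 + p.2 + 1 : ℕ) + a) * y)))
      (Real.exp ((1 - a) * (x + y)) / (Real.exp (x + y) - 1) * (1 / (Real.exp y - 1))) := by
  have h1 := hasSum_exp_neg_natCast_add_mul (b := a) (add_pos hx hy)
  have h2 := hasSum_exp_neg_natCast_add_mul (b := 1) hy
  have h3 := h1.mul h2 (h1.summable.mul_of_nonneg h2.summable
    (fun _ => (Real.exp_pos _).le) (fun _ => (Real.exp_pos _).le))
  convert! h3 using 1
  · ext p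
    rw [← Real.exp_add, ← Real.exp_add]
    push_cast
    ring_nf
  · simp

/-- Pairs `m < n` of naturals, parametrised by `(m, n - m - 1)`. -/
def natPairEquivLt : ℕ × ℕ ≃ {q : ℕ × ℕ // q.1 < q.2} where
  toFun p := ⟨(p.1, p.1 + p.2 + 1), by simp only; omega⟩
  invFun q := (q.1.1, q.1.2 - q.1.1 - 1)
  left_inv p := by ext <;> simp only; omega
  right_inv q := by
    obtain ⟨⟨m, n⟩, h⟩ := q
    ext <;> simp only
    simp only at h
    omega

lemma gamma_mul_doubleZeta_eq_integral_prod {a : ℝ} (ha : 0 < a) {s₁ s₂ : ℂ}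
    (h1 : 0 < s₁.re) (h2 : 0 < s₂.re)
    (hint : Integrable (fun p : ℝ × ℝ => (p.2 : ℂ) ^ (s₂ - 1) / ((Real.exp p.2 : ℂ) - 1) *
        (((Real.exp ((1 - a) * (p.1 + p.2)) / (Real.exp (p.1 + p.2) - 1) : ℝ) : ℂ) *
          (p.1 : ℂ) ^ (s₁ - 1)))
      ((volume.restrict (Ioi 0)).prod (volume.restrict (Ioi 0)))) :
    Complex.Gamma s₁ * Complex.Gamma s₂ * doubleZeta a s₁ s₂ =
      ∫ p : ℝ × ℝ, (p.2 : ℂ) ^ (s₂ - 1) / ((Real.exp p.2 : ℂ) - 1) *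
        (((Real.exp ((1 - a) * (p.1 + p.2)) / (Real.exp (p.1 + p.2) - 1) : ℝ) : ℂ) *
          (p.1 : ℂ) ^ (s₁ - 1)) ∂((volume.restrict (Ioi 0)).prod (volume.restrict (Ioi 0))) := by
  have hpos : ∀ᵐ p : ℝ × ℝ ∂((volume.restrict (Ioi 0)).prod (volume.restrict (Ioi 0))),
      0 < p.1 ∧ 0 < p.2 := by
    rw [Measure.prod_restrict]
    filter_upwards [ae_restrict_mem (measurableSet_Ioi.prod measurableSet_Ioi)] with p hp
    exact hp
  have hcast : ∀ p : ℝ × ℝ, (p.2 : ℂ) ^ (s₂ - 1) / ((Real.exp p.2 : ℂ) - 1) *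
        (((Real.exp ((1 - a) * (p.1 + p.2)) / (Real.exp (p.1 + p.2) - 1) : ℝ) : ℂ) *
          (p.1 : ℂ) ^ (s₁ - 1)) = ((p.1 : ℂ) ^ (s₁ - 1) * (p.2 : ℂ) ^ (s₂ - 1)) *
        ((Real.exp ((1 - a) * (p.1 + p.2)) / (Real.exp (p.1 + p.2) - 1) *
          (1 / (Real.exp p.2 - 1)) : ℝ) : ℂ) := fun p => by
    push_cast; ring
  simp only [hcast] at hint ⊢
  have key := hasSum_integral_of_dominated_convergence
    (μ := (volume.restrict (Ioi (0 : ℝ))).prod (volume.restrict (Ioi (0 : ℝ))))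
    (F := fun (q : ℕ × ℕ) (p : ℝ × ℝ) =>
      ((p.1 : ℂ) ^ (s₁ - 1) * (Real.exp (-((q.1 + a) * p.1)) : ℂ)) *
      ((p.2 : ℂ) ^ (s₂ - 1) * (Real.exp (-(((q.1 + q.2 + 1 : ℕ) + a) * p.2)) : ℂ)))
    (f := fun p => ((p.1 : ℂ) ^ (s₁ - 1) * (p.2 : ℂ) ^ (s₂ - 1)) *
        ((Real.exp ((1 - a) * (p.1 + p.2)) / (Real.exp (p.1 + p.2) - 1) *
          (1 / (Real.exp p.2 - 1)) : ℝ) : ℂ))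
    (fun q p => ‖(p.1 : ℂ) ^ (s₁ - 1) * (p.2 : ℂ) ^ (s₂ - 1)‖ *
      (Real.exp (-((q.1 + a) * p.1)) * Real.exp (-(((q.1 + q.2 + 1 : ℕ) + a) * p.2))))
    (fun q => by fun_prop)
    (fun q => .of_forall fun p => by
      simp only [norm_mul, Complex.norm_real, Real.norm_eq_abs, Real.abs_exp]
      exact le_of_eq (by ring))
    (by
      filter_upwards [hpos] with p hp
      exact (hasSum_exp_mul_exp hp.1 hp.2).summable.mul_left _)
    (by
      refine hint.norm.congr ?_
      filter_upwards [hpos] with p hp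
      rw [((hasSum_exp_mul_exp hp.1 hp.2).mul_left _).tsum_eq, norm_mul, Complex.norm_real,
        Real.norm_of_nonneg]
      exact (hasSum_exp_mul_exp hp.1 hp.2).nonneg fun _ => by positivity)
    (by
      filter_upwards [hpos] with p hp
      convert! (Complex.hasSum_ofReal.2 (hasSum_exp_mul_exp (a := a) hp.1 hp.2)).mul_left
        ((p.1 : ℂ) ^ (s₁ - 1) * (p.2 : ℂ) ^ (s₂ - 1)) using 1
      ext q
      push_cast
      ring)
  rw [← key.tsum_eq, doubleZeta, ← natPairEquivLt.tsum_eq, ← tsum_mul_left]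
  refine tsum_congr fun q => ?_
  have hq1 : (0 : ℝ) < q.1 + a := by positivity
  have hq2 : (0 : ℝ) < (q.1 + q.2 + 1 : ℕ) + a := by positivity
  rw [integral_prod_mul (fun x : ℝ => (x : ℂ) ^ (s₁ - 1) * (Real.exp (-((q.1 + a) * x)) : ℂ))
    (fun y : ℝ => (y : ℂ) ^ (s₂ - 1) * (Real.exp (-(((q.1 + q.2 + 1 : ℕ) + a) * y)) : ℂ)),
    integral_cpow_mul_ofReal_exp h1 hq1, integral_cpow_mul_ofReal_exp h2 hq2]
  simp only [natPairEquivLt, Equiv.coe_fn_mk]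
  push_cast
  ring

theorem gamma_mul_doubleZeta_eq_integral_H (a : ℝ) (ha : 0 < a) (ha' : a ≤ 1)
    (s₁ s₂ : ℂ) (h1 : 0 < s₁.re) (h1' : s₁.re < 1) (h2 : 1 < s₂.re)
    (h12 : 2 < (s₁ + s₂).re) :
    MeasureTheory.IntegrableOn
      (fun p : ℝ × ℝ => (p.2 : ℂ) ^ (s₂ - 1) / ((Real.exp p.2 : ℂ) - 1) *
        ((Hfun a (p.1 + p.2) : ℂ) * (p.1 : ℂ) ^ (s₁ - 1)))
      (Ioi (0 : ℝ) ×ˢ Ioi (0 : ℝ)) ∧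
    Complex.Gamma s₁ * Complex.Gamma s₂ * doubleZeta a s₁ s₂ =
      (∫ y in Ioi (0 : ℝ), (y : ℂ) ^ (s₂ - 1) / ((Real.exp y : ℂ) - 1) *
          ∫ x in Ioi (0 : ℝ), (Hfun a (x + y) : ℂ) * (x : ℂ) ^ (s₁ - 1)) +
        Complex.Gamma s₁ * Complex.Gamma (1 - s₁) *
          ∫ y in Ioi (0 : ℝ), (y : ℂ) ^ (s₁ + s₂ - 2) / ((Real.exp y : ℂ) - 1) := by
  have hker := integrable_kernel h1 h1' h12
  have hG : Integrable (fun p : ℝ × ℝ => (p.2 : ℂ) ^ (s₂ - 1) / ((Real.exp p.2 : ℂ) - 1) *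
        (((Real.exp ((1 - a) * (p.1 + p.2)) / (Real.exp (p.1 + p.2) - 1) : ℝ) : ℂ) *
          (p.1 : ℂ) ^ (s₁ - 1)))
      ((volume.restrict (Ioi 0)).prod (volume.restrict (Ioi 0))) := by
    have hm : Measurable (fun p : ℝ × ℝ => (p.2 : ℂ) ^ (s₂ - 1) / ((Real.exp p.2 : ℂ) - 1) *
        (((Real.exp ((1 - a) * (p.1 + p.2)) / (Real.exp (p.1 + p.2) - 1) : ℝ) : ℂ) *
          (p.1 : ℂ) ^ (s₁ - 1))) := by fun_prop
    refine Integrable.mono' (hker.norm.const_mul (1 + 1 / a)) hm.aestronglyMeasurable ?_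
    rw [Measure.prod_restrict]
    filter_upwards [ae_restrict_mem (measurableSet_Ioi.prod measurableSet_Ioi)] with p hp
    have hxy : 0 < p.1 + p.2 := add_pos hp.1 hp.2
    have he : 0 < Real.exp (p.1 + p.2) - 1 := by linarith [Real.add_one_lt_exp hxy.ne']
    rw [norm_mul, norm_mul, norm_mul, norm_mul, Complex.norm_real, Complex.norm_real,
      Real.norm_of_nonneg (by positivity), Real.norm_of_nonneg (by positivity)]
    calc _ ≤ ‖(p.2 : ℂ) ^ (s₂ - 1) / ((Real.exp p.2 : ℂ) - 1)‖ *
          ((1 + 1 / a) * (1 / (p.1 + p.2)) * ‖(p.1 : ℂ) ^ (s₁ - 1)‖) := by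
          gcongr
          exact exp_div_exp_sub_one_le ha hxy
      _ = _ := by ring
  have hsub : (fun p : ℝ × ℝ => (p.2 : ℂ) ^ (s₂ - 1) / ((Real.exp p.2 : ℂ) - 1) *
        ((Hfun a (p.1 + p.2) : ℂ) * (p.1 : ℂ) ^ (s₁ - 1))) = fun p : ℝ × ℝ =>
        (p.2 : ℂ) ^ (s₂ - 1) / ((Real.exp p.2 : ℂ) - 1) *
        (((Real.exp ((1 - a) * (p.1 + p.2)) / (Real.exp (p.1 + p.2) - 1) : ℝ) : ℂ) *
          (p.1 : ℂ) ^ (s₁ - 1)) - (p.2 : ℂ) ^ (s₂ - 1) / ((Real.exp p.2 : ℂ) - 1) *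
        ((p.1 : ℂ) ^ (s₁ - 1) * ((1 / (p.1 + p.2) : ℝ) : ℂ)) := by
    ext p
    rw [Hfun, Complex.ofReal_sub]
    ring
  have hH : Integrable (fun p : ℝ × ℝ => (p.2 : ℂ) ^ (s₂ - 1) / ((Real.exp p.2 : ℂ) - 1) *
        ((Hfun a (p.1 + p.2) : ℂ) * (p.1 : ℂ) ^ (s₁ - 1)))
      ((volume.restrict (Ioi 0)).prod (volume.restrict (Ioi 0))) := by
    rw [hsub]
    exact hG.sub hker
  refine ⟨?_, ?_⟩
  · rwa [Measure.prod_restrict] at hH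
  · have hI := integral_sub hG hker
    rw [← hsub, ← gamma_mul_doubleZeta_eq_integral_prod ha h1 (by linarith) hG,
      integral_prod_symm _ hH, integral_prod_symm _ hker] at hI
    simp only [integral_const_mul] at hI
    rw [← sub_eq_iff_eq_add, hI, ← integral_const_mul]
    congr 1
    refine setIntegral_congr_fun measurableSet_Ioi fun y hy => ?_
    have hy : 0 < y := hy
    rw [integral_cpow_mul_one_div_add h1 h1' hy,
      show s₁ + s₂ - 2 = (s₁ - 1) + (s₂ - 1) by ring,
      Complex.cpow_add _ _ (Complex.ofReal_ne_zero.2 hy.ne')]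
    ring
end
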